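/- arXiv:0808.2851 — 3 statements merged into one kernel-verified Lean document; each statement's English description precedes it below -/
import Mathlib

section
/- Let E_ν : N_{ν+1} → N_{ν+1} be the linear map determined on elementary Kronecker tensors by E_ν(x ⊗ y) = ρ_1(y) · (x ⊗ 1_2) for x ∈ N_ν, y ∈ M_2(ℂ). Then for every 1 ≤ p ≤ ∞ and every z ∈ N_{ν+1}, ‖E_ν(z)‖_{p,♯} ≤ ‖z‖_{p,♯}; in particular E_ν is a norm-one projection of (N_{ν+1}, ‖·‖_♯) onto N_ν ⊗ 1_2. -/
open Finset
open scoped ENNReal ComplexOrder Kronecker Matrix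

noncomputable section

/-- Kronecker product of square complex matrices, realized on `Fin (m * n)`. -/
def kron {m n : ℕ} (x : Matrix (Fin m) (Fin m) ℂ) (y : Matrix (Fin n) (Fin n) ℂ) :
    Matrix (Fin (m * n)) (Fin (m * n)) ℂ :=
  Matrix.reindex finProdFinEquiv finProdFinEquiv (x ⊗ₖ y)

/-- The matrix `A₁ = diag(α, 1 - α)`. -/
def A1 (α : ℝ) : Matrix (Fin 2) (Fin 2) ℂ :=
  Matrix.diagonal ![(α : ℂ), ((1 - α : ℝ) : ℂ)]

/-- The matrix `A₁^t = diag(α^t, (1 - α)^t)` (entrywise real power on the diagonal). -/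
def A1t (α t : ℝ) : Matrix (Fin 2) (Fin 2) ℂ :=
  Matrix.diagonal ![((α ^ t : ℝ) : ℂ), (((1 - α) ^ t : ℝ) : ℂ)]

/-- `Amat α ν = A_ν`, the ν-fold Kronecker power of `diag(α, 1-α)`. -/
def Amat (α : ℝ) : (ν : ℕ) → Matrix (Fin (2 ^ ν)) (Fin (2 ^ ν)) ℂ
  | 0 => 1
  | ν + 1 => kron (Amat α ν) (A1 α)

/-- `Amatt α t ν = A_ν^t`, the ν-fold Kronecker power of `diag(α^t, (1-α)^t)`. -/
def Amatt (α t : ℝ) : (ν : ℕ) → Matrix (Fin (2 ^ ν)) (Fin (2 ^ ν)) ℂ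
  | 0 => 1
  | ν + 1 => kron (Amatt α t ν) (A1t α t)

/-- The state `ρ_ν(x) = Tr (x A_ν)` on `N_ν = M_{2^ν}(ℂ)`. -/
def rho (α : ℝ) (ν : ℕ) (x : Matrix (Fin (2 ^ ν)) (Fin (2 ^ ν)) ℂ) : ℂ :=
  (x * Amat α ν).trace

/-- The state `ρ_1(x) = Tr (x A_1)` on `M_2(ℂ)`. -/
def rho1 (α : ℝ) (x : Matrix (Fin 2) (Fin 2) ℂ) : ℂ :=
  (x * A1 α).trace

/-- The Schatten `p`-norm `‖x‖_{C_p} = (Tr ((x^* x)^{p/2}))^{1/p}`, `1 ≤ p < ∞`,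
computed through the eigenvalues of the positive semidefinite matrix `x^* x`. -/
def schatten {N : ℕ} (p : ℝ) (x : Matrix (Fin N) (Fin N) ℂ) : ℝ :=
  (∑ i, ((Matrix.posSemidef_conjTranspose_mul_self x).isHermitian.eigenvalues i) ^ (p / 2)) ^
    (1 / p)

/-- The operator norm `‖x‖ = ‖x‖_{C_∞}` of a complex matrix (acting on ℓ²). -/
def opNorm {N : ℕ} (x : Matrix (Fin N) (Fin N) ℂ) : ℝ :=
  ‖Matrix.toEuclideanCLM (𝕜 := ℂ) x‖

/-- The left predual norm `‖x‖_♯ = ‖x A_ν‖_{C_1}` on `N_ν`. -/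
def sharpNorm (α : ℝ) {ν : ℕ} (x : Matrix (Fin (2 ^ ν)) (Fin (2 ^ ν)) ℂ) : ℝ :=
  schatten 1 (x * Amat α ν)

/-- The right predual norm `‖x‖_♭ = ‖A_ν x‖_{C_1}` on `N_ν`. -/
def flatNorm (α : ℝ) {ν : ℕ} (x : Matrix (Fin (2 ^ ν)) (Fin (2 ^ ν)) ℂ) : ℝ :=
  schatten 1 (Amat α ν * x)

/-- The left predual norm `‖x‖_♯ = ‖x A_1‖_{C_1}` on `M_2(ℂ)`. -/
def sharp2 (α : ℝ) (x : Matrix (Fin 2) (Fin 2) ℂ) : ℝ :=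
  schatten 1 (x * A1 α)

/-- The right predual norm `‖x‖_♭ = ‖A_1 x‖_{C_1}` on `M_2(ℂ)`. -/
def flat2 (α : ℝ) (x : Matrix (Fin 2) (Fin 2) ℂ) : ℝ :=
  schatten 1 (A1 α * x)

/-- The left norm `‖x‖_{p,♯} = ‖x A_ν^{1/p}‖_{C_p}` on `N_ν`, `1 ≤ p ≤ ∞`
(for `p = ∞` it is the operator norm). -/
def lpSharp (α : ℝ) (p : ℝ≥0∞) {ν : ℕ} (x : Matrix (Fin (2 ^ ν)) (Fin (2 ^ ν)) ℂ) : ℝ :=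
  if p = ∞ then opNorm x else schatten p.toReal (x * Amatt α (1 / p.toReal) ν)

/-- The right norm `‖x‖_{p,♭} = ‖A_ν^{1/p} x‖_{C_p}` on `N_ν`, `1 ≤ p ≤ ∞`. -/
def lpFlat (α : ℝ) (p : ℝ≥0∞) {ν : ℕ} (x : Matrix (Fin (2 ^ ν)) (Fin (2 ^ ν)) ℂ) : ℝ :=
  if p = ∞ then opNorm x else schatten p.toReal (Amatt α (1 / p.toReal) ν * x)

/-- The left norm `‖x‖_{p,♯} = ‖x A_1^{1/p}‖_{C_p}` on `M_2(ℂ)`. -/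
def lp2Sharp (α : ℝ) (p : ℝ≥0∞) (x : Matrix (Fin 2) (Fin 2) ℂ) : ℝ :=
  if p = ∞ then opNorm x else schatten p.toReal (x * A1t α (1 / p.toReal))

/-- `shellNum r c` is `s(r+1, c+1) - 1`, the zero-based shell enumeration index of the
matrix unit `E_{r c}` (zero-based indices `r`, `c`): `s(r,c) = (c-1)² + r` if `r ≤ c`
and `s(r,c) = r² - c + 1` if `r > c` (one-based). -/
def shellNum (r c : ℕ) : ℕ :=
  if r ≤ c then c * c + r else r * r + 2 * r - c

/-- `eUnit N m` is the `m`-th matrix unit `e_m` of `M_N(ℂ)` in the shell enumeration: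
`e_{s(r,c) - 1} = E_{r c}`. -/
def eUnit (N m : ℕ) : Matrix (Fin N) (Fin N) ℂ :=
  Matrix.of fun r c => if shellNum (r : ℕ) (c : ℕ) = m then 1 else 0

/-- The left Haar system `h^{(ν)}_j` in `N_ν` built from `r_0, r_1, r_2, r_3 ∈ M_2(ℂ)`:
`h^{(1)}_j = r_j`, and for `j = 4^ν q + k` (`0 ≤ q ≤ 3`, `0 ≤ k < 4^ν`),
`h^{(ν+1)}_j = h^{(ν)}_k ⊗ r_0` if `q = 0` and `h^{(ν+1)}_j = e^{(ν)}_k ⊗ r_q` if `q ≠ 0`. -/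
def haar (r : ℕ → Matrix (Fin 2) (Fin 2) ℂ) :
    (ν : ℕ) → ℕ → Matrix (Fin (2 ^ ν)) (Fin (2 ^ ν)) ℂ
  | 0, _ => 1
  | 1, j => r (j % 4)
  | ν + 2, j =>
      if j / 4 ^ (ν + 1) = 0 then kron (haar r (ν + 1) j) (r 0)
      else kron (eUnit (2 ^ (ν + 1)) (j % 4 ^ (ν + 1))) (r (j / 4 ^ (ν + 1) % 4))


theorem aux_svd {n : Type*} [Fintype n] [DecidableEq n] (x : Matrix n n ℂ) :
    ∃ U ∈ Matrix.unitaryGroup n ℂ, ∃ V ∈ Matrix.unitaryGroup n ℂ,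
      x = U * Matrix.diagonal (fun i => ((√((Matrix.posSemidef_conjTranspose_mul_self
        x).isHermitian.eigenvalues i) : ℝ) : ℂ)) * Vᴴ := by
  set h := (Matrix.posSemidef_conjTranspose_mul_self x).isHermitian with hh
  have hnn : ∀ i, 0 ≤ h.eigenvalues i :=
    (Matrix.posSemidef_conjTranspose_mul_self x).eigenvalues_nonneg
  set V : Matrix n n ℂ := (h.eigenvectorUnitary : Matrix n n ℂ) with hV
  have hVmem : V ∈ Matrix.unitaryGroup n ℂ := h.eigenvectorUnitary.2
  have hV1 : Vᴴ * V = 1 := Matrix.mem_unitaryGroup_iff'.1 hVmem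
  have hV2 : V * Vᴴ = 1 := Matrix.mem_unitaryGroup_iff.1 hVmem
  have hspec : xᴴ * x = V * Matrix.diagonal (fun i => ((h.eigenvalues i : ℝ) : ℂ)) * Vᴴ := by
    have := h.spectral_theorem
    rw [Unitary.conjStarAlgAut_apply] at this
    exact this
  set W := x * V with hW
  have hWW : Wᴴ * W = Matrix.diagonal (fun i => ((h.eigenvalues i : ℝ) : ℂ)) := by
    calc Wᴴ * W = Vᴴ * (xᴴ * x) * V := by
          rw [hW, Matrix.conjTranspose_mul]; simp only [Matrix.mul_assoc]
      _ = (Vᴴ * V) * Matrix.diagonal (fun i => ((h.eigenvalues i : ℝ) : ℂ)) * (Vᴴ * V) := by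
          refine (congrArg (fun Y => Vᴴ * Y * V) hspec).trans ?_
          simp only [Matrix.mul_assoc]
      _ = _ := by rw [hV1]; simp
  have hent : ∀ i j, ∑ k, star (W k i) * W k j = if i = j then ((h.eigenvalues i : ℝ) : ℂ) else 0 := by
    intro i j
    have := congrFun (congrFun hWW i) j
    rw [Matrix.mul_apply, Matrix.diagonal_apply] at this
    simpa [Matrix.conjTranspose_apply] using this
  let t : n → ℝ := fun i => √(h.eigenvalues i)
  have ht : ∀ i, t i * t i = h.eigenvalues i := fun i => Real.mul_self_sqrt (hnn i)
  let v : n → EuclideanSpace ℂ n := fun i => WithLp.toLp 2 (fun k => ((t i : ℝ) : ℂ)⁻¹ * W k i)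
  let s : Set n := {i | h.eigenvalues i ≠ 0}
  have hv : Orthonormal ℂ (s.domRestrict v) := by
    rw [orthonormal_iff_ite]
    rintro ⟨i, hi⟩ ⟨j, hj⟩
    have hti : (t i : ℂ) ≠ 0 := by
      intro h0
      have h0' : t i = 0 := by exact_mod_cast h0
      apply hi
      rw [← ht i, h0']; simp
    have h1 : inner ℂ (v i) (v j) = ((t i : ℝ) : ℂ)⁻¹ * ((t j : ℝ) : ℂ)⁻¹ * ∑ k, star (W k i) * W k j := by
      simp only [v, PiLp.inner_apply, Finset.mul_sum, RCLike.inner_apply]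
      refine Finset.sum_congr rfl fun k _ => ?_
      simp
      ring
    change inner ℂ (v i) (v j) = _
    rw [h1, hent]
    by_cases hij : i = j
    · subst hij
      simp only [if_true]
      rw [← ht i]
      push_cast
      field_simp
    · simp [hij]
  obtain ⟨b, hb⟩ := hv.exists_orthonormalBasis_extension_of_card_eq (by simp)
  let U : Matrix n n ℂ := Matrix.of fun k i => b i k
  have hU : Uᴴ * U = 1 := by
    ext i j
    have := orthonormal_iff_ite.1 b.orthonormal i j
    rw [Matrix.mul_apply, Matrix.one_apply, ← this]
    simp [U, PiLp.inner_apply, Matrix.conjTranspose_apply, mul_comm]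
  refine ⟨U, Matrix.mem_unitaryGroup_iff'.2 hU, V, hVmem, ?_⟩
  have hWU : W = U * Matrix.diagonal (fun i => ((t i : ℝ) : ℂ)) := by
    ext k i
    rw [Matrix.mul_diagonal]
    by_cases hi : h.eigenvalues i = 0
    · have h0 : t i = 0 := by simp [t, hi]
      have h1 := hent i i
      simp only [if_true, hi] at h1
      have h2 : ∑ k, ‖W k i‖ ^ 2 = 0 := by
        have : ((∑ k, ‖W k i‖ ^ 2 : ℝ) : ℂ) = 0 := by
          push_cast
          rw [← Complex.ofReal_zero, ← h1]
          refine Finset.sum_congr rfl fun k _ => ?_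
          rw [← Complex.conj_mul']; rfl
        exact_mod_cast this
      have h3 := (Finset.sum_eq_zero_iff_of_nonneg (fun k _ => by positivity)).1 h2 k (Finset.mem_univ k)
      have h4 : W k i = 0 := by simpa using h3
      rw [h4, h0]; simp
    · have hbi := hb i hi
      have hti : (t i : ℂ) ≠ 0 := by
        intro h0
        have h0' : t i = 0 := by exact_mod_cast h0
        apply hi
        rw [← ht i, h0']; simp
      simp only [U, Matrix.of_apply, hbi, v]
      field_simp
  calc x = W * Vᴴ := by rw [hW, Matrix.mul_assoc, hV2, Matrix.mul_one]
    _ = _ := by rw [hWU]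

theorem aux_row {n : Type*} [Fintype n] [DecidableEq n] {M : Matrix n n ℂ}
    (hM : M ∈ Matrix.unitaryGroup n ℂ) (i : n) : ∑ j, ‖M i j‖ ^ 2 = 1 := by
  have h := congrFun (congrFun (Matrix.mem_unitaryGroup_iff.1 hM) i) i
  rw [Matrix.mul_apply, Matrix.one_apply_eq] at h
  have : ((∑ j, ‖M i j‖ ^ 2 : ℝ) : ℂ) = 1 := by
    push_cast
    rw [← h]
    refine Finset.sum_congr rfl fun k _ => ?_
    rw [← Complex.mul_conj']; rfl
  exact_mod_cast this

theorem aux_col {n : Type*} [Fintype n] [DecidableEq n] {M : Matrix n n ℂ}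
    (hM : M ∈ Matrix.unitaryGroup n ℂ) (j : n) : ∑ i, ‖M i j‖ ^ 2 = 1 := by
  have h := aux_row (Unitary.star_mem hM) j
  simpa [Matrix.star_apply] using h

/-- Diagonal entries in orthonormal bases are dominated by the singular values. -/
theorem aux_key {n : Type*} [Fintype n] [DecidableEq n] {p : ℝ} (hp : 1 ≤ p)
    {U V P Q : Matrix n n ℂ} (hU : U ∈ Matrix.unitaryGroup n ℂ) (hV : V ∈ Matrix.unitaryGroup n ℂ)
    (hP : P ∈ Matrix.unitaryGroup n ℂ) (hQ : Q ∈ Matrix.unitaryGroup n ℂ)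
    {t : n → ℝ} (ht : ∀ i, 0 ≤ t i) :
    ∑ i, ‖(Pᴴ * (U * Matrix.diagonal (fun i => (t i : ℂ)) * Vᴴ) * Q) i i‖ ^ p ≤ ∑ i, t i ^ p := by
  set M := Pᴴ * U with hMdef
  set R := Vᴴ * Q with hRdef
  have hM : M ∈ Matrix.unitaryGroup n ℂ := mul_mem (Unitary.star_mem hP) hU
  have hR : R ∈ Matrix.unitaryGroup n ℂ := mul_mem (Unitary.star_mem hV) hQ
  have heq : Pᴴ * (U * Matrix.diagonal (fun i => (t i : ℂ)) * Vᴴ) * Q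
      = M * Matrix.diagonal (fun i => (t i : ℂ)) * R := by
    simp only [hMdef, hRdef, Matrix.mul_assoc]
  rw [heq]
  let c : n → n → ℝ := fun i j => (‖M i j‖ ^ 2 + ‖R j i‖ ^ 2) / 2
  have hc0 : ∀ i j, 0 ≤ c i j := fun i j => by positivity
  have hrow : ∀ i, ∑ j, c i j = 1 := by
    intro i
    simp only [c]
    rw [← Finset.sum_div, Finset.sum_add_distrib, aux_row hM, aux_col hR]; norm_num
  have hcol : ∀ j, ∑ i, c i j = 1 := by
    intro j
    simp only [c]
    rw [← Finset.sum_div, Finset.sum_add_distrib, aux_col hM, aux_row hR]; norm_num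
  have hi : ∀ i, ‖(M * Matrix.diagonal (fun i => (t i : ℂ)) * R) i i‖ ^ p ≤ ∑ j, c i j * t j ^ p := by
    intro i
    refine le_trans ?_ (Real.rpow_arith_mean_le_arith_mean_rpow Finset.univ (c i) t
      (fun j _ => hc0 i j) (hrow i) (fun j _ => ht j) hp)
    refine Real.rpow_le_rpow (norm_nonneg _) ?_ (by linarith)
    rw [Matrix.mul_apply]
    refine (norm_sum_le _ _).trans (Finset.sum_le_sum fun j _ => ?_)
    rw [Matrix.mul_diagonal, norm_mul, norm_mul, Complex.norm_real, Real.norm_of_nonneg (ht j)]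
    have : ‖M i j‖ * ‖R j i‖ ≤ c i j := by
      simp only [c]; nlinarith [sq_nonneg (‖M i j‖ - ‖R j i‖)]
    nlinarith [ht j, mul_le_mul_of_nonneg_right this (ht j)]
  calc _ ≤ ∑ i, ∑ j, c i j * t j ^ p := Finset.sum_le_sum fun i _ => hi i
    _ = ∑ j, (∑ i, c i j) * t j ^ p := by
        rw [Finset.sum_comm]; simp only [Finset.sum_mul]
    _ = _ := by simp [hcol]

theorem aux_sqrt_rpow {a : ℝ} (ha : 0 ≤ a) (p : ℝ) : √a ^ p = a ^ (p / 2) := by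
  rw [Real.sqrt_eq_rpow, ← Real.rpow_mul ha]; congr 1; ring

/-- diagonal entries are bounded by the Schatten sum -/
theorem aux_lower {n : Type*} [Fintype n] [DecidableEq n] {p : ℝ} (hp : 1 ≤ p)
    (x : Matrix n n ℂ) {P Q : Matrix n n ℂ}
    (hP : P ∈ Matrix.unitaryGroup n ℂ) (hQ : Q ∈ Matrix.unitaryGroup n ℂ) :
    ∑ i, ‖(Pᴴ * x * Q) i i‖ ^ p ≤ ∑ i, ((Matrix.posSemidef_conjTranspose_mul_self
        x).isHermitian.eigenvalues i) ^ (p / 2) := by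
  obtain ⟨U, hU, V, hV, hx⟩ := aux_svd x
  have h := aux_key hp hU hV hP hQ (t := fun i => √((Matrix.posSemidef_conjTranspose_mul_self
        x).isHermitian.eigenvalues i)) (fun i => Real.sqrt_nonneg _)
  rw [← hx] at h
  refine h.trans (le_of_eq (Finset.sum_congr rfl fun i _ => ?_))
  exact aux_sqrt_rpow ((Matrix.posSemidef_conjTranspose_mul_self x).eigenvalues_nonneg i) p

theorem aux_upper {n : Type*} [Fintype n] [DecidableEq n] {p : ℝ} (hp : 1 ≤ p)
    {P Q : Matrix n n ℂ}
    (hP : P ∈ Matrix.unitaryGroup n ℂ) (hQ : Q ∈ Matrix.unitaryGroup n ℂ) {t : n → ℝ}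
    (ht : ∀ i, 0 ≤ t i) (x : Matrix n n ℂ)
    (hx : x = P * Matrix.diagonal (fun i => (t i : ℂ)) * Qᴴ) :
    ∑ i, ((Matrix.posSemidef_conjTranspose_mul_self
        x).isHermitian.eigenvalues i) ^ (p / 2) ≤ ∑ i, t i ^ p := by
  obtain ⟨U, hU, V, hV, hx'⟩ := aux_svd x
  have h := aux_key hp hP hQ hU hV ht
  rw [← hx] at h
  refine le_trans (le_of_eq (Finset.sum_congr rfl fun i _ => ?_)) h
  have hU1 : Uᴴ * U = 1 := Matrix.mem_unitaryGroup_iff'.1 hU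
  have hV1 : Vᴴ * V = 1 := Matrix.mem_unitaryGroup_iff'.1 hV
  set D := Matrix.diagonal (fun i => ((√((Matrix.posSemidef_conjTranspose_mul_self
        x).isHermitian.eigenvalues i) : ℝ) : ℂ)) with hD
  have h2 : Uᴴ * x * V = D := by
    calc Uᴴ * x * V = Uᴴ * (U * D * Vᴴ) * V := by rw [← hx']
      _ = (Uᴴ * U) * D * (Vᴴ * V) := by simp only [Matrix.mul_assoc]
      _ = D := by rw [hU1, hV1]; simp
  rw [h2, hD, Matrix.diagonal_apply_eq, Complex.norm_real, Real.norm_of_nonneg (Real.sqrt_nonneg _)]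
  exact (aux_sqrt_rpow ((Matrix.posSemidef_conjTranspose_mul_self x).eigenvalues_nonneg i) p).symm

theorem aux_svd' {n : Type*} [Fintype n] [DecidableEq n] (x : Matrix n n ℂ) :
    ∃ s : n → ℝ, (∀ i, 0 ≤ s i) ∧ ∃ U ∈ Matrix.unitaryGroup n ℂ, ∃ V ∈ Matrix.unitaryGroup n ℂ,
      x = U * Matrix.diagonal (fun i => (s i : ℂ)) * Vᴴ :=
  ⟨_, fun _ => Real.sqrt_nonneg _, aux_svd x⟩

theorem kron_apply' {m n : ℕ} (x : Matrix (Fin m) (Fin m) ℂ) (y : Matrix (Fin n) (Fin n) ℂ)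
    (i j : Fin m) (k l : Fin n) :
    kron x y (finProdFinEquiv (i, k)) (finProdFinEquiv (j, l)) = x i j * y k l := by
  simp only [kron, Matrix.reindex_apply, Matrix.submatrix_apply, Equiv.symm_apply_apply,
    Matrix.kroneckerMap_apply]

theorem ext_prod {m n : ℕ} {x y : Matrix (Fin (m * n)) (Fin (m * n)) ℂ}
    (h : ∀ i k j l, x (finProdFinEquiv (i, k)) (finProdFinEquiv (j, l))
      = y (finProdFinEquiv (i, k)) (finProdFinEquiv (j, l))) : x = y := by
  ext a b
  obtain ⟨⟨i, k⟩, rfl⟩ := finProdFinEquiv.surjective a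
  obtain ⟨⟨j, l⟩, rfl⟩ := finProdFinEquiv.surjective b
  exact h i k j l

theorem sum_prod' {m n : ℕ} {β : Type*} [AddCommMonoid β] (f : Fin (m * n) → β) :
    ∑ a, f a = ∑ i, ∑ k, f (finProdFinEquiv (i, k)) := by
  rw [← Fintype.sum_prod_type' (f := fun i k => f (finProdFinEquiv (i, k)))]
  exact (Equiv.sum_comp finProdFinEquiv f).symm

theorem kron_mul' {m n : ℕ} (x x' : Matrix (Fin m) (Fin m) ℂ) (y y' : Matrix (Fin n) (Fin n) ℂ) :
    kron x y * kron x' y' = kron (x * x') (y * y') := by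
  simp only [kron, Matrix.reindex_apply, Matrix.submatrix_mul_equiv, Matrix.mul_kronecker_mul]

theorem kron_conjTranspose' {m n : ℕ} (x : Matrix (Fin m) (Fin m) ℂ)
    (y : Matrix (Fin n) (Fin n) ℂ) : (kron x y)ᴴ = kron xᴴ yᴴ := by
  apply ext_prod
  intro i k j l
  simp [kron_apply', Matrix.conjTranspose_apply]

theorem kron_one' {m n : ℕ} :
    kron (1 : Matrix (Fin m) (Fin m) ℂ) (1 : Matrix (Fin n) (Fin n) ℂ) = 1 := by
  simp [kron]

theorem kron_unitary {m n : ℕ} {U : Matrix (Fin m) (Fin m) ℂ}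
    (hU : U ∈ Matrix.unitaryGroup (Fin m) ℂ) :
    kron U (1 : Matrix (Fin n) (Fin n) ℂ) ∈ Matrix.unitaryGroup (Fin (m * n)) ℂ := by
  have h : Uᴴ * U = 1 := Matrix.mem_unitaryGroup_iff'.1 hU
  rw [Matrix.mem_unitaryGroup_iff', Matrix.star_eq_conjTranspose, kron_conjTranspose', kron_mul', h]
  simp [kron_one']

/-- The `k`-th diagonal block. -/
def blk {m : ℕ} (x : Matrix (Fin (m * 2)) (Fin (m * 2)) ℂ) (k : Fin 2) :
    Matrix (Fin m) (Fin m) ℂ :=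
  Matrix.of fun i j => x (finProdFinEquiv (i, k)) (finProdFinEquiv (j, k))

theorem blk_mul_kron {m : ℕ} (x : Matrix (Fin (m * 2)) (Fin (m * 2)) ℂ)
    (B : Matrix (Fin m) (Fin m) ℂ) (d : Fin 2 → ℂ) (k : Fin 2) :
    blk (x * kron B (Matrix.diagonal d)) k = d k • (blk x k * B) := by
  ext i j
  simp only [blk, Matrix.of_apply, Matrix.mul_apply, sum_prod', kron_apply', Matrix.smul_apply,
    Matrix.diagonal_apply, smul_eq_mul, Finset.mul_sum]
  refine Finset.sum_congr rfl fun a _ => ?_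
  simp
  ring

theorem blk_kron_mul {m : ℕ} (x : Matrix (Fin (m * 2)) (Fin (m * 2)) ℂ)
    (B : Matrix (Fin m) (Fin m) ℂ) (k : Fin 2) :
    blk (kron B 1 * x) k = B * blk x k := by
  ext i j
  simp only [blk, Matrix.of_apply, Matrix.mul_apply, sum_prod', kron_apply', Matrix.one_apply]
  refine Finset.sum_congr rfl fun a _ => ?_
  simp

theorem blk_conj {m : ℕ} (x : Matrix (Fin (m * 2)) (Fin (m * 2)) ℂ)
    (P Q : Matrix (Fin m) (Fin m) ℂ) (k : Fin 2) :
    blk ((kron P 1)ᴴ * x * kron Q 1) k = Pᴴ * blk x k * Q := by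
  rw [kron_conjTranspose', ← Matrix.diagonal_one, blk_mul_kron, Matrix.diagonal_one,
    Matrix.conjTranspose_one, blk_kron_mul, one_smul]

/-- The weights `(α, 1 - α)`. -/
def wt (α : ℝ) : Fin 2 → ℝ := ![α, 1 - α]

theorem aux_E {m : ℕ} (α : ℝ) (E : Matrix (Fin (m * 2)) (Fin (m * 2)) ℂ →ₗ[ℂ]
      Matrix (Fin (m * 2)) (Fin (m * 2)) ℂ)
    (hE : ∀ (x : Matrix (Fin m) (Fin m) ℂ) (y : Matrix (Fin 2) (Fin 2) ℂ),
      E (kron x y) = rho1 α y • kron x (1 : Matrix (Fin 2) (Fin 2) ℂ))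
    (z : Matrix (Fin (m * 2)) (Fin (m * 2)) ℂ) :
    E z = kron (∑ k, (wt α k : ℂ) • blk z k) 1 := by
  let F : Matrix (Fin (m * 2)) (Fin (m * 2)) ℂ →ₗ[ℂ] Matrix (Fin (m * 2)) (Fin (m * 2)) ℂ :=
    { toFun := fun z => kron (∑ k, (wt α k : ℂ) • blk z k) 1
      map_add' := by
        intro x y
        apply ext_prod
        intro i k j l
        simp only [Matrix.add_apply, kron_apply', Matrix.sum_apply, Matrix.smul_apply, blk,
          Matrix.of_apply, Fin.sum_univ_two, smul_eq_mul]
        ring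
      map_smul' := by
        intro c x
        apply ext_prod
        intro i k j l
        simp only [Matrix.add_apply, kron_apply', Matrix.sum_apply, Matrix.smul_apply, blk,
          Matrix.of_apply, Fin.sum_univ_two, smul_eq_mul, RingHom.id_apply]
        ring }
  have hF : E = F := by
    apply Matrix.ext_linearMap
    intro a b
    obtain ⟨⟨i, k⟩, rfl⟩ := finProdFinEquiv.surjective a
    obtain ⟨⟨j, l⟩, rfl⟩ := finProdFinEquiv.surjective b
    ext1
    have hs : Matrix.single (finProdFinEquiv (i, k)) (finProdFinEquiv (j, l)) (1 : ℂ)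
        = kron (Matrix.single i j 1) (Matrix.single k l 1) := by
      apply ext_prod
      intro i' k' j' l'
      simp only [kron_apply', Matrix.single_apply, EmbeddingLike.apply_eq_iff_eq, Prod.mk.injEq]
      split_ifs <;> simp_all
    change E (Matrix.single _ _ 1) = F (Matrix.single _ _ 1)
    rw [hs, hE]
    change _ = kron (∑ k', (wt α k' : ℂ) • blk _ k') 1
    apply ext_prod
    intro i' k' j' l'
    simp only [Matrix.smul_apply, kron_apply', Matrix.sum_apply, blk, Matrix.of_apply, smul_eq_mul,
      rho1, A1, Matrix.trace, Matrix.diag_apply, Matrix.mul_diagonal, Fin.sum_univ_two, wt]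
    simp
    ring
  rw [hF]; rfl

theorem aux_main {m : ℕ} (α : ℝ) (hα0 : 0 < α) (hα : α ≤ 1 / 2)
    (B : Matrix (Fin m) (Fin m) ℂ) {p : ℝ} (hp : 1 ≤ p)
    (z : Matrix (Fin (m * 2)) (Fin (m * 2)) ℂ) :
    schatten p (kron (∑ k, (wt α k : ℂ) • blk z k) 1 * kron B (A1t α (1 / p)))
      ≤ schatten p (z * kron B (A1t α (1 / p))) := by
  have hp0 : p ≠ 0 := by linarith
  have hw0 : ∀ k, 0 ≤ wt α k := by
    intro k; fin_cases k <;> simp [wt] <;> linarith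
  have hw1 : ∑ k, wt α k = 1 := by simp [wt]
  have hA : A1t α (1 / p) = Matrix.diagonal (fun k => ((wt α k ^ (1 / p) : ℝ) : ℂ)) := by
    unfold A1t
    congr 1
    ext k; fin_cases k <;> simp [wt]
  have hwp : ∀ k, (wt α k ^ (1 / p)) ^ p = wt α k := by
    intro k
    rw [← Real.rpow_mul (hw0 k), one_div_mul_cancel hp0, Real.rpow_one]
  unfold schatten
  refine Real.rpow_le_rpow (Finset.sum_nonneg fun i _ => Real.rpow_nonneg
    ((Matrix.posSemidef_conjTranspose_mul_self _).eigenvalues_nonneg i) _) ?_ (by positivity)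
  rw [kron_mul', Matrix.one_mul, hA]
  set y := (∑ k, (wt α k : ℂ) • blk z k) * B with hy
  obtain ⟨s, hs0, U, hU, V, hV, hyd'⟩ := aux_svd' y
  have hU1 : Uᴴ * U = 1 := Matrix.mem_unitaryGroup_iff'.1 hU
  have hV1 : Vᴴ * V = 1 := Matrix.mem_unitaryGroup_iff'.1 hV
  have hD : Uᴴ * y * V = Matrix.diagonal (fun i => (s i : ℂ)) := by
    calc Uᴴ * y * V = (Uᴴ * U) * Matrix.diagonal (fun i => (s i : ℂ)) * (Vᴴ * V) := by
          rw [hyd']; simp only [Matrix.mul_assoc]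
      _ = _ := by rw [hU1, hV1]; simp
  let t : Fin (m * 2) → ℝ := fun a =>
    s (finProdFinEquiv.symm a).1 * wt α (finProdFinEquiv.symm a).2 ^ (1 / p)
  have ht0 : ∀ a, 0 ≤ t a := fun a => mul_nonneg (hs0 _) (Real.rpow_nonneg (hw0 _) _)
  have hdec : kron y (Matrix.diagonal (fun k => ((wt α k ^ (1 / p) : ℝ) : ℂ)))
      = kron U 1 * Matrix.diagonal (fun a => (t a : ℂ)) * (kron V 1)ᴴ := by
    have : Matrix.diagonal (fun a => (t a : ℂ)) = kron (Matrix.diagonal (fun i => (s i : ℂ)))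
        (Matrix.diagonal (fun k => ((wt α k ^ (1 / p) : ℝ) : ℂ))) := by
      apply ext_prod
      intro i k j l
      simp only [kron_apply', Matrix.diagonal_apply, EmbeddingLike.apply_eq_iff_eq, Prod.mk.injEq, t]
      by_cases h1 : i = j <;> by_cases h2 : k = l <;> simp [h1, h2]
    rw [this, kron_conjTranspose', kron_mul', kron_mul', ← hyd']
    simp
  refine (aux_upper hp (kron_unitary hU) (kron_unitary hV) ht0 _ hdec).trans ?_
  refine le_trans ?_ (aux_lower hp _ (kron_unitary hU) (kron_unitary hV))
  rw [sum_prod', sum_prod']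
  refine Finset.sum_le_sum fun i _ => ?_
  have hleft : ∑ k, t (finProdFinEquiv (i, k)) ^ p = s i ^ p := by
    simp only [t, Equiv.symm_apply_apply]
    have : ∀ k, (s i * wt α k ^ (1 / p)) ^ p = s i ^ p * wt α k := by
      intro k
      rw [Real.mul_rpow (hs0 i) (Real.rpow_nonneg (hw0 k) _), hwp]
    simp only [this]
    rw [← Finset.mul_sum, hw1, mul_one]
  rw [hleft]
  have hent : ∀ k, ‖((kron U (1 : Matrix (Fin 2) (Fin 2) ℂ))ᴴ * (z * kron B (Matrix.diagonal
      (fun k => ((wt α k ^ (1 / p) : ℝ) : ℂ)))) * kron V (1 : Matrix (Fin 2) (Fin 2) ℂ) :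
      Matrix (Fin (m * 2)) (Fin (m * 2)) ℂ)
      (finProdFinEquiv (i, k)) (finProdFinEquiv (i, k))‖ ^ p
      = wt α k * ‖(Uᴴ * (blk z k * B) * V) i i‖ ^ p := by
    intro k
    have h := congrFun (congrFun (blk_conj (z * kron B (Matrix.diagonal
      (fun k => ((wt α k ^ (1 / p) : ℝ) : ℂ)))) U V k) i) i
    rw [blk_mul_kron] at h
    simp only [blk, Matrix.of_apply] at h
    rw [h, Matrix.mul_smul, Matrix.smul_mul, Matrix.smul_apply, norm_smul, Complex.norm_real,
      Real.norm_of_nonneg (Real.rpow_nonneg (hw0 k) _),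
      Real.mul_rpow (Real.rpow_nonneg (hw0 k) _) (norm_nonneg _), hwp]
    rfl
  simp only [hent]
  refine le_trans ?_ (Real.rpow_arith_mean_le_arith_mean_rpow Finset.univ (wt α) _
      (fun j _ => hw0 j) hw1 (fun j _ => norm_nonneg _) hp)
  refine Real.rpow_le_rpow (hs0 i) ?_ (by linarith)
  have hsi : (s i : ℂ) = ∑ k, (wt α k : ℂ) * (Uᴴ * (blk z k * B) * V) i i := by
    have h := congrFun (congrFun hD i) i
    rw [Matrix.diagonal_apply_eq, hy] at h
    rw [← h]
    simp only [Finset.sum_mul, Finset.mul_sum, Matrix.sum_apply, Matrix.smul_mul, Matrix.mul_smul,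
      Matrix.smul_apply, smul_eq_mul]
  calc s i = ‖(s i : ℂ)‖ := by rw [Complex.norm_real, Real.norm_of_nonneg (hs0 i)]
    _ ≤ _ := by
      rw [hsi]
      refine (norm_sum_le _ _).trans (le_of_eq (Finset.sum_congr rfl fun k _ => ?_))
      rw [norm_mul, Complex.norm_real, Real.norm_of_nonneg (hw0 k)]

open scoped Matrix.Norms.L2Operator in
theorem aux_entry {n : Type*} [Fintype n] [DecidableEq n] (x : Matrix n n ℂ) (i j : n) :
    ‖x i j‖ ≤ ‖x‖ := by
  have h := Matrix.l2_opNorm_mulVec x (EuclideanSpace.single j 1)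
  have h2 := PiLp.norm_apply_le (WithLp.toLp 2 (x *ᵥ (EuclideanSpace.single j (1:ℂ)))) i
  simp at h h2
  exact h2.trans h

open scoped Matrix.Norms.L2Operator in
theorem aux_inf {m : ℕ} (α : ℝ) (hα0 : 0 < α) (hα : α ≤ 1 / 2)
    (z : Matrix (Fin (m * 2)) (Fin (m * 2)) ℂ) :
    opNorm (kron (∑ k, (wt α k : ℂ) • blk z k) (1 : Matrix (Fin 2) (Fin 2) ℂ)) ≤ opNorm z := by
  have hw0 : ∀ k, 0 ≤ wt α k := by
    intro k; fin_cases k <;> simp [wt] <;> linarith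
  have hw1 : ∑ k, wt α k = 1 := by simp [wt]
  unfold opNorm
  rw [Matrix.l2_opNorm_toEuclideanCLM, Matrix.l2_opNorm_toEuclideanCLM]
  set y := (∑ k, (wt α k : ℂ) • blk z k) with hy
  obtain ⟨s, hs0, U, hU, V, hV, hyd'⟩ := aux_svd' y
  have hU1 : Uᴴ * U = 1 := Matrix.mem_unitaryGroup_iff'.1 hU
  have hV1 : Vᴴ * V = 1 := Matrix.mem_unitaryGroup_iff'.1 hV
  have hD : Uᴴ * y * V = Matrix.diagonal (fun i => (s i : ℂ)) := by
    calc Uᴴ * y * V = (Uᴴ * U) * Matrix.diagonal (fun i => (s i : ℂ)) * (Vᴴ * V) := by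
          rw [hyd']; simp only [Matrix.mul_assoc]
      _ = _ := by rw [hU1, hV1]; simp
  have hdec : kron y (1 : Matrix (Fin 2) (Fin 2) ℂ)
      = kron U 1 * Matrix.diagonal (fun a : Fin (m * 2) => (s (finProdFinEquiv.symm a).1 : ℂ))
        * star (kron V 1) := by
    have : Matrix.diagonal (fun a : Fin (m * 2) => (s (finProdFinEquiv.symm a).1 : ℂ))
        = kron (Matrix.diagonal (fun i => (s i : ℂ))) 1 := by
      apply ext_prod
      intro i k j l
      simp only [kron_apply', Matrix.diagonal_apply, Matrix.one_apply,
        EmbeddingLike.apply_eq_iff_eq, Prod.mk.injEq]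
      by_cases h1 : i = j <;> by_cases h2 : k = l <;> simp [h1, h2]
    rw [this, Matrix.star_eq_conjTranspose, kron_conjTranspose', kron_mul', kron_mul',
      Matrix.conjTranspose_one, Matrix.one_mul, Matrix.one_mul, ← hyd']
  rw [hdec, CStarRing.norm_mul_mem_unitary _ (Unitary.star_mem (kron_unitary hV)),
    CStarRing.norm_mem_unitary_mul _ (kron_unitary hU), Matrix.l2_opNorm_diagonal]
  rw [pi_norm_le_iff_of_nonneg (norm_nonneg _)]
  intro a
  generalize (finProdFinEquiv.symm a).1 = i
  have hsi : (s i : ℂ) = ∑ k, (wt α k : ℂ) * (Uᴴ * blk z k * V) i i := by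
    have h := congrFun (congrFun hD i) i
    rw [Matrix.diagonal_apply_eq, hy] at h
    rw [← h]
    simp only [Finset.sum_mul, Finset.mul_sum, Matrix.sum_apply, Matrix.smul_mul, Matrix.mul_smul,
      Matrix.smul_apply, smul_eq_mul]
  rw [hsi]
  have hb : ∀ k, ‖(Uᴴ * blk z k * V) i i‖ ≤ ‖z‖ := by
    intro k
    rw [← blk_conj]
    simp only [blk, Matrix.of_apply]
    refine (aux_entry _ _ _).trans (le_of_eq ?_)
    rw [CStarRing.norm_mul_mem_unitary _ (kron_unitary hV), ← Matrix.star_eq_conjTranspose,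
      CStarRing.norm_mem_unitary_mul _ (Unitary.star_mem (kron_unitary hU))]
  calc _ ≤ ∑ k, ‖(wt α k : ℂ) * (Uᴴ * blk z k * V) i i‖ := norm_sum_le _ _
    _ ≤ ∑ k, wt α k * ‖z‖ := by
        refine Finset.sum_le_sum fun k _ => ?_
        rw [norm_mul, Complex.norm_real, Real.norm_of_nonneg (hw0 k)]
        exact mul_le_mul_of_nonneg_left (hb k) (hw0 k)
    _ = ‖z‖ := by rw [← Finset.sum_mul, hw1, one_mul]

/-- the conditional expectation `E_ν(x ⊗ y) = ρ_1(y)(x ⊗ 1₂)` is a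
norm-one projection for every left norm `‖·‖_{p,♯}`, `1 ≤ p ≤ ∞`. -/
theorem conditional_expectation_contractive_lp
    (α : ℝ) (hα0 : 0 < α) (hα : α ≤ 1 / 2) (ν : ℕ) (hν : 1 ≤ ν)
    (E : Matrix (Fin (2 ^ (ν + 1))) (Fin (2 ^ (ν + 1))) ℂ →ₗ[ℂ]
      Matrix (Fin (2 ^ (ν + 1))) (Fin (2 ^ (ν + 1))) ℂ)
    (hE : ∀ (x : Matrix (Fin (2 ^ ν)) (Fin (2 ^ ν)) ℂ) (y : Matrix (Fin 2) (Fin 2) ℂ),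
      E (kron x y) = rho1 α y • kron x (1 : Matrix (Fin 2) (Fin 2) ℂ)) :
    ∀ p : ℝ≥0∞, 1 ≤ p → ∀ z, lpSharp α p (E z) ≤ lpSharp α p z := by
  intro p hp z
  have hEz := aux_E (m := 2 ^ ν) α E hE z
  unfold lpSharp
  split_ifs with hpt
  · exact (congrArg (opNorm (N := 2 ^ ν * 2)) hEz).trans_le (aux_inf α hα0 hα z)
  · have hp1 : 1 ≤ p.toReal := by
      have := ENNReal.toReal_mono hpt hp
      simpa using this
    exact (congrArg (fun w => schatten (N := 2 ^ ν * 2) p.toReal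
      (w * kron (Amatt α (1 / p.toReal) ν) (A1t α (1 / p.toReal)))) hEz).trans_le
      (aux_main α hα0 hα (Amatt α (1 / p.toReal) ν) hp1 z)

end
end

section
/- Let r_0, r_1, r_2, r_3 ∈ M_2(ℂ) satisfy ρ_1(r_j* r_k) = δ_{jk}, and let E_ν : N_{ν+1} → N_{ν+1} be the linear map determined by E_ν(x ⊗ y) = ρ_1(y)·(x ⊗ 1_2). Then for 0 ≤ j < 4^{ν+1}: (i) E_ν((1_{2^ν} ⊗ r_0)* · h^{(ν+1)}_j) = h^{(ν)}_j ⊗ 1_2 if 0 ≤ j < 4^ν, and = 0 if j ≥ 4^ν; (ii) for each 1 ≤ q ≤ 3, E_ν((1_{2^ν} ⊗ r_q)* · h^{(ν+1)}_j) = e^{(ν)}_{j − q·4^ν} ⊗ 1_2 if q·4^ν ≤ j < (q+1)·4^ν, and = 0 otherwise. -/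
open Finset
open scoped ENNReal ComplexOrder Kronecker Matrix

noncomputable section

/-- Matrix multiplication with the size pinned explicitly (used to multiply matrices whose
sizes `2^ν * 2` and `2^(ν+1)` are definitionally equal). -/
def mulM {N : ℕ} (x y : Matrix (Fin N) (Fin N) ℂ) : Matrix (Fin N) (Fin N) ℂ := x * y

theorem mulM_kron {m n : ℕ} (a b : Matrix (Fin n) (Fin n) ℂ) (x : Matrix (Fin m) (Fin m) ℂ) :
    mulM ((kron (1 : Matrix (Fin m) (Fin m) ℂ) a)ᴴ) (kron x b) = kron x (aᴴ * b) := by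
  unfold mulM kron
  rw [Matrix.conjTranspose_reindex, Matrix.conjTranspose_kronecker]
  simp only [Matrix.reindex_apply, Matrix.conjTranspose_one]
  rw [Matrix.submatrix_mul_equiv, ← Matrix.mul_kronecker_mul, one_mul]

theorem haar_succ_eq (r : ℕ → Matrix (Fin 2) (Fin 2) ℂ) (ν : ℕ) (hν : 1 ≤ ν) (j : ℕ)
    (hj : j < 4 ^ (ν + 1)) :
    haar r (ν + 1) j = kron (if j / 4 ^ ν = 0 then haar r ν j else eUnit (2 ^ ν) (j % 4 ^ ν))
      (r (j / 4 ^ ν)) := by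
  obtain ⟨μ, rfl⟩ : ∃ μ, ν = μ + 1 := ⟨ν - 1, by omega⟩
  have h4 : j / 4 ^ (μ + 1) < 4 := by
    rw [Nat.div_lt_iff_lt_mul (by positivity)]
    rw [pow_succ] at hj
    linarith
  rw [haar]
  by_cases h : j / 4 ^ (μ + 1) = 0
  · refine (if_pos h).trans ?_
    rw [if_pos h, h]
  · refine (if_neg h).trans ?_
    rw [if_neg h, Nat.mod_eq_of_lt h4]

theorem kron_cond_exp
    (α : ℝ) (r : ℕ → Matrix (Fin 2) (Fin 2) ℂ)
    (hr : ∀ j < 4, ∀ k < 4, rho1 α ((r j)ᴴ * r k) = if j = k then 1 else 0)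
    (ν : ℕ) (hν : 1 ≤ ν)
    (E : Matrix (Fin (2 ^ (ν + 1))) (Fin (2 ^ (ν + 1))) ℂ →ₗ[ℂ]
      Matrix (Fin (2 ^ (ν + 1))) (Fin (2 ^ (ν + 1))) ℂ)
    (hE : ∀ (x : Matrix (Fin (2 ^ ν)) (Fin (2 ^ ν)) ℂ) (y : Matrix (Fin 2) (Fin 2) ℂ),
      E (kron x y) = rho1 α y • kron x (1 : Matrix (Fin 2) (Fin 2) ℂ))
    (q : ℕ) (hq : q < 4) (j : ℕ) (hj : j < 4 ^ (ν + 1)) :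
    E (mulM ((kron (1 : Matrix (Fin (2 ^ ν)) (Fin (2 ^ ν)) ℂ) (r q))ᴴ) (haar r (ν + 1) j)) =
      (if q = j / 4 ^ ν then (1 : ℂ) else 0) •
        kron (if j / 4 ^ ν = 0 then haar r ν j else eUnit (2 ^ ν) (j % 4 ^ ν))
          (1 : Matrix (Fin 2) (Fin 2) ℂ) := by
  have h4 : j / 4 ^ ν < 4 := by
    rw [Nat.div_lt_iff_lt_mul (by positivity)]
    rw [pow_succ] at hj
    linarith
  rw [haar_succ_eq r ν hν j hj]
  have := mulM_kron (r q) (r (j / 4 ^ ν))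
    (if j / 4 ^ ν = 0 then haar r ν j else eUnit (2 ^ ν) (j % 4 ^ ν))
  refine (congrArg E this).trans ?_
  rw [hE, hr q hq _ h4]

/-- action of the conditional expectation on the Haar system:
`E_ν((1 ⊗ r_0)^* h^{(ν+1)}_j)` and `E_ν((1 ⊗ r_q)^* h^{(ν+1)}_j)`. -/
theorem haar_conditional_expectation_relations
    (α : ℝ) (hα0 : 0 < α) (hα : α ≤ 1 / 2)
    (r : ℕ → Matrix (Fin 2) (Fin 2) ℂ)
    (hr : ∀ j < 4, ∀ k < 4, rho1 α ((r j)ᴴ * r k) = if j = k then 1 else 0)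
    (ν : ℕ) (hν : 1 ≤ ν)
    (E : Matrix (Fin (2 ^ (ν + 1))) (Fin (2 ^ (ν + 1))) ℂ →ₗ[ℂ]
      Matrix (Fin (2 ^ (ν + 1))) (Fin (2 ^ (ν + 1))) ℂ)
    (hE : ∀ (x : Matrix (Fin (2 ^ ν)) (Fin (2 ^ ν)) ℂ) (y : Matrix (Fin 2) (Fin 2) ℂ),
      E (kron x y) = rho1 α y • kron x (1 : Matrix (Fin 2) (Fin 2) ℂ)) :
    (∀ j < 4 ^ (ν + 1),
      (j < 4 ^ ν →
        E (mulM ((kron (1 : Matrix (Fin (2 ^ ν)) (Fin (2 ^ ν)) ℂ) (r 0))ᴴ)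
            (haar r (ν + 1) j)) =
          kron (haar r ν j) (1 : Matrix (Fin 2) (Fin 2) ℂ)) ∧
      (4 ^ ν ≤ j →
        E (mulM ((kron (1 : Matrix (Fin (2 ^ ν)) (Fin (2 ^ ν)) ℂ) (r 0))ᴴ)
            (haar r (ν + 1) j)) = 0)) ∧
    (∀ q, 1 ≤ q → q ≤ 3 → ∀ j < 4 ^ (ν + 1),
      (q * 4 ^ ν ≤ j → j < (q + 1) * 4 ^ ν →
        E (mulM ((kron (1 : Matrix (Fin (2 ^ ν)) (Fin (2 ^ ν)) ℂ) (r q))ᴴ)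
            (haar r (ν + 1) j)) =
          kron (eUnit (2 ^ ν) (j - q * 4 ^ ν)) (1 : Matrix (Fin 2) (Fin 2) ℂ)) ∧
      (¬(q * 4 ^ ν ≤ j ∧ j < (q + 1) * 4 ^ ν) →
        E (mulM ((kron (1 : Matrix (Fin (2 ^ ν)) (Fin (2 ^ ν)) ℂ) (r q))ᴴ)
            (haar r (ν + 1) j)) = 0)) := by
  have key := kron_cond_exp α r hr ν hν E hE
  have hpos : 0 < 4 ^ ν := by positivity
  refine ⟨fun j hj => ⟨fun h => ?_, fun h => ?_⟩,
    fun q hq1 hq3 j hj => ⟨fun h1 h2 => ?_, fun h => ?_⟩⟩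
  · have h0 : j / 4 ^ ν = 0 := Nat.div_eq_of_lt h
    refine (key 0 (by norm_num) j hj).trans ?_
    rw [if_pos h0.symm, if_pos h0, one_smul]
  · have h0 : 0 < j / 4 ^ ν := Nat.div_pos h hpos
    refine (key 0 (by norm_num) j hj).trans ?_
    rw [if_neg (by omega), zero_smul]
    rfl
  · have h0 : j / 4 ^ ν = q := Nat.div_eq_of_lt_le h1 h2
    have h5 : j % 4 ^ ν = j - q * 4 ^ ν := by
      have := Nat.div_add_mod j (4 ^ ν)
      rw [h0, mul_comm] at this
      omega
    refine (key q (by omega) j hj).trans ?_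
    rw [if_pos h0.symm, if_neg (by omega), one_smul, h5]
  · refine (key q (by omega) j hj).trans ?_
    have hne : ¬ q = j / 4 ^ ν := by
      intro h0
      apply h
      rw [h0]
      refine ⟨Nat.div_mul_le_self _ _, ?_⟩
      rw [mul_comm]
      exact Nat.lt_mul_div_succ j hpos
    rw [if_neg hne, zero_smul]
    rfl

end
end

section
/- Let 0 < α ≤ 1/2, λ = α/(1−α), and let m_α be the Borel probability measure on [0,1) which is the image of the infinite product Bernoulli measure on {0,1}^ℕ assigning mass α to 0 and 1−α to 1, under the binary expansion map (ε_s)_{s≥0} ↦ Σ_{s≥0} ε_s 2^{−s−1}; equivalently m_α([k·2^{−ν}, (k+1)·2^{−ν})) = Π_{s=0}^{ν−1} [(1−ε_s)α + ε_s(1−α)] where ε_0, …, ε_{ν−1} are the binary digits of k = Σ ε_s 2^s. Define χ_0 = 1 and, for ν ≥ 0 and j = 2^ν + k with 0 ≤ k < 2^ν, χ_j = λ^{−1/2}·1_{[2k·2^{−ν−1}, (2k+1)·2^{−ν−1})} − λ^{1/2}·1_{[(2k+1)·2^{−ν−1}, (2k+2)·2^{−ν−1})}. Then (χ_j)_{j≥0}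 is a Schauder basis of L¹([0,1), m_α): for every f ∈ L¹([0,1), m_α) there exists a unique sequence of complex scalars (c_j) such that f = Σ_{j≥0} c_j χ_j with the series converging in L¹(m_α)-norm. (For α = 1/2 this is the classical Haar basis of L¹(0,1).) -/
open Finset
open scoped ENNReal ComplexOrder Kronecker Matrix

noncomputable section

/-- The (commutative) Haar system adapted to the distorted measure `m_α`:
`χ_0 = 1` and, for `j = 2^ν + k` (`0 ≤ k < 2^ν`),
`χ_j = λ^{-1/2} 1_{[2k/2^{ν+1}, (2k+1)/2^{ν+1})} - λ^{1/2} 1_{[(2k+1)/2^{ν+1}, (2k+2)/2^{ν+1})}`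
with `λ = α/(1-α)`. -/
def chi (α : ℝ) (j : ℕ) : ℝ → ℂ :=
  if j = 0 then fun _ => 1
  else fun x =>
    let ν := Nat.log 2 j
    let k := j - 2 ^ ν
    if (2 * k : ℝ) / 2 ^ (ν + 1) ≤ x ∧ x < ((2 * k + 1 : ℕ) : ℝ) / 2 ^ (ν + 1) then
      (((Real.sqrt (α / (1 - α)))⁻¹ : ℝ) : ℂ)
    else if ((2 * k + 1 : ℕ) : ℝ) / 2 ^ (ν + 1) ≤ x ∧ x < ((2 * k + 2 : ℕ) : ℝ) / 2 ^ (ν + 1) then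
      -((Real.sqrt (α / (1 - α)) : ℝ) : ℂ)
    else 0

namespace ChiBasis
open MeasureTheory

/-- The dyadic interval `[k 2^{-ν}, (k+1) 2^{-ν})`. -/
def I (ν k : ℕ) : Set ℝ := Set.Ico ((k : ℝ) / 2 ^ ν) (((k : ℝ) + 1) / 2 ^ ν)

lemma measI (ν k : ℕ) : MeasurableSet (I ν k) := measurableSet_Ico

lemma mem_I_iff {ν k : ℕ} {x : ℝ} : x ∈ I ν k ↔ (k : ℝ) ≤ x * 2 ^ ν ∧ x * 2 ^ ν < k + 1 := by
  have h : (0 : ℝ) < 2 ^ ν := by positivity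
  rw [I, Set.mem_Ico, div_le_iff₀ h, lt_div_iff₀ h]

lemma nonneg_of_mem {ν k : ℕ} {x : ℝ} (hx : x ∈ I ν k) : 0 ≤ x :=
  le_trans (by positivity) hx.1

lemma mem_I {ν k : ℕ} {x : ℝ} (hx : 0 ≤ x) : x ∈ I ν k ↔ ⌊x * 2 ^ ν⌋₊ = k := by
  rw [mem_I_iff, Nat.floor_eq_iff (by positivity)]

lemma floor_half {ν d : ℕ} {x : ℝ} :
    ⌊x * 2 ^ ν⌋₊ = ⌊x * 2 ^ (ν + d)⌋₊ / 2 ^ d := by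
  have := Nat.floor_div_natCast (x * 2 ^ (ν + d)) (2 ^ d)
  rw [← this]
  congr 1
  push_cast
  rw [pow_add]
  field_simp

lemma I_split (ν k : ℕ) : I ν k = I (ν + 1) (2 * k) ∪ I (ν + 1) (2 * k + 1) := by
  ext x
  by_cases hx : 0 ≤ x
  · rw [Set.mem_union, mem_I hx, mem_I hx, mem_I hx, floor_half (ν := ν) (d := 1)]
    omega
  · constructor
    · intro h; exact absurd (nonneg_of_mem h) hx
    · rintro (h | h) <;> exact absurd (nonneg_of_mem h) hx

lemma I_disj (ν : ℕ) {k l : ℕ} (h : k ≠ l) : Disjoint (I ν k) (I ν l) := by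
  rw [Set.disjoint_left]
  intro x hx hx'
  have h0 := nonneg_of_mem hx
  rw [mem_I h0] at hx hx'
  omega

lemma I_union (ν : ℕ) : (⋃ k ∈ Finset.range (2 ^ ν), I ν k) = Set.Ico (0 : ℝ) 1 := by
  ext x
  simp only [Set.mem_iUnion, Finset.mem_range, exists_prop]
  constructor
  · rintro ⟨k, hk, hx⟩
    refine ⟨nonneg_of_mem hx, ?_⟩
    have h := (mem_I_iff.1 hx).2
    have h2 : ((k : ℝ) + 1) ≤ 2 ^ ν := by exact_mod_cast hk
    have h3 : (0 : ℝ) < 2 ^ ν := by positivity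
    by_contra hc
    push Not at hc
    nlinarith
  · intro hx
    refine ⟨⌊x * 2 ^ ν⌋₊, ?_, (mem_I hx.1).2 rfl⟩
    rw [Nat.floor_lt (by have := hx.1; positivity)]
    push_cast
    have h3 : (0 : ℝ) < 2 ^ ν := by positivity
    nlinarith [hx.2]

lemma log_eq {ν k : ℕ} (hk : k < 2 ^ ν) : Nat.log 2 (2 ^ ν + k) = ν := by
  rw [Nat.log_eq_iff (by right; constructor <;> [norm_num; positivity])]
  constructor
  · omega
  · rw [pow_succ]; omega

lemma exists_idx {j : ℕ} (hj : j ≠ 0) : ∃ ν k, k < 2 ^ ν ∧ j = 2 ^ ν + k := by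
  have h1 := Nat.pow_log_le_self 2 hj
  have h2 := Nat.lt_pow_succ_log_self (b := 2) (by norm_num) j
  refine ⟨Nat.log 2 j, j - 2 ^ Nat.log 2 j, ?_, by omega⟩
  rw [pow_succ] at h2
  omega

/-- square root of `λ`. -/
def r (α : ℝ) : ℝ := Real.sqrt (α / (1 - α))

lemma chi_eq (α : ℝ) {ν k : ℕ} (hk : k < 2 ^ ν) (x : ℝ) :
    chi α (2 ^ ν + k) x = (I (ν + 1) (2 * k)).indicator (fun _ => (((r α)⁻¹ : ℝ) : ℂ)) x
      + (I (ν + 1) (2 * k + 1)).indicator (fun _ => -((r α : ℝ) : ℂ)) x := by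
  have h0 : 2 ^ ν + k ≠ 0 := by positivity
  have hd : x ∈ I (ν + 1) (2 * k) → x ∉ I (ν + 1) (2 * k + 1) := fun h h' =>
    Set.disjoint_left.1 (I_disj (ν + 1) (by omega)) h h'
  rw [chi, if_neg h0]
  simp only [log_eq hk, Nat.add_sub_cancel_left]
  have e1 : ((2 * k : ℝ) / 2 ^ (ν + 1) ≤ x ∧ x < ((2 * k + 1 : ℕ) : ℝ) / 2 ^ (ν + 1))
      ↔ x ∈ I (ν + 1) (2 * k) := by
    rw [I, Set.mem_Ico]; push_cast; rfl
  have e2 : (((2 * k + 1 : ℕ) : ℝ) / 2 ^ (ν + 1) ≤ x ∧ x < ((2 * k + 2 : ℕ) : ℝ) / 2 ^ (ν + 1))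
      ↔ x ∈ I (ν + 1) (2 * k + 1) := by
    rw [I, Set.mem_Ico]; push_cast; rw [add_assoc]; norm_num
  by_cases h1 : x ∈ I (ν + 1) (2 * k)
  · rw [if_pos (e1.2 h1)]
    simp [h1, hd h1, r]
  · rw [if_neg (fun h => h1 (e1.1 h))]
    by_cases h2 : x ∈ I (ν + 1) (2 * k + 1)
    · rw [if_pos (e2.2 h2)]
      simp [h1, h2, r]
    · rw [if_neg (fun h => h2 (e2.1 h))]
      simp [h1, h2]

lemma chi_left (α : ℝ) {ν k : ℕ} (hk : k < 2 ^ ν) {x : ℝ} (hx : x ∈ I (ν + 1) (2 * k)) :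
    chi α (2 ^ ν + k) x = (((r α)⁻¹ : ℝ) : ℂ) := by
  have hd : x ∉ I (ν + 1) (2 * k + 1) := fun h' =>
    Set.disjoint_left.1 (I_disj (ν + 1) (by omega)) hx h'
  simp [chi_eq α hk, hx, hd]

lemma chi_right (α : ℝ) {ν k : ℕ} (hk : k < 2 ^ ν) {x : ℝ} (hx : x ∈ I (ν + 1) (2 * k + 1)) :
    chi α (2 ^ ν + k) x = -((r α : ℝ) : ℂ) := by
  have hd : x ∉ I (ν + 1) (2 * k) := fun h' =>
    Set.disjoint_left.1 (I_disj (ν + 1) (by omega)) hx h'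
  simp [chi_eq α hk, hx, hd]

lemma chi_out (α : ℝ) {ν k : ℕ} (hk : k < 2 ^ ν) {x : ℝ} (hx : x ∉ I ν k) :
    chi α (2 ^ ν + k) x = 0 := by
  rw [I_split, Set.mem_union, not_or] at hx
  simp [chi_eq α hk, hx.1, hx.2]

lemma chi_zero (α x : ℝ) : chi α 0 x = 1 := by simp [chi]

lemma chi_meas (α : ℝ) (j : ℕ) : Measurable (chi α j) := by
  rcases eq_or_ne j 0 with rfl | hj
  · have : chi α 0 = fun _ => 1 := by ext x; exact chi_zero α x
    rw [this]; exact measurable_const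
  · obtain ⟨ν, k, hk, rfl⟩ := exists_idx hj
    have := funext (chi_eq α hk)
    rw [this]
    exact (measurable_const.indicator (measI _ _)).add (measurable_const.indicator (measI _ _))

/-- The uniform bound. -/
def M (α : ℝ) : ℝ := 1 + r α + (r α)⁻¹

lemma r_nonneg (α : ℝ) : 0 ≤ r α := Real.sqrt_nonneg _

lemma M_nonneg (α : ℝ) : 0 ≤ M α := by
  have := r_nonneg α
  have := inv_nonneg.2 this
  unfold M; linarith

lemma chi_bound (α : ℝ) (j : ℕ) (x : ℝ) : ‖chi α j x‖ ≤ M α := by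
  have h1 := r_nonneg α
  have h2 := inv_nonneg.2 h1
  rcases eq_or_ne j 0 with rfl | hj
  · rw [chi_zero, norm_one]; unfold M; linarith
  · obtain ⟨ν, k, hk, rfl⟩ := exists_idx hj
    by_cases hx : x ∈ I ν k
    · rw [I_split] at hx
      rcases hx with hx | hx
      · rw [chi_left α hk hx, Complex.norm_real, Real.norm_of_nonneg h2]; unfold M; linarith
      · rw [chi_right α hk hx, norm_neg, Complex.norm_real, Real.norm_of_nonneg h1]
        unfold M; linarith
    · rw [chi_out α hk hx, norm_zero]; exact M_nonneg α

/-- Earlier functions are constant on the support of later ones. -/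
lemma chi_const (α : ℝ) {i ν k : ℕ} (hk : k < 2 ^ ν) (hi : i < 2 ^ ν + k) :
    ∃ v : ℂ, ∀ x ∈ I ν k, chi α i x = v := by
  rcases eq_or_ne i 0 with rfl | hi0
  · exact ⟨1, fun x _ => chi_zero α x⟩
  obtain ⟨ν', k', hk', rfl⟩ := exists_idx hi0
  have hle : ν' ≤ ν := by
    by_contra hc
    have : 2 ^ (ν + 1) ≤ 2 ^ ν' := Nat.pow_le_pow_right (by norm_num) (by omega)
    rw [pow_succ] at this
    omega
  rcases hle.eq_or_lt with rfl | hlt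
  · refine ⟨0, fun x hx => chi_out α hk' fun hx' => ?_⟩
    exact Set.disjoint_left.1 (I_disj ν' (by omega)) hx hx'
  · obtain ⟨d, rfl⟩ : ∃ d, ν = ν' + 1 + d := ⟨ν - (ν' + 1), by omega⟩
    have key : ∀ x ∈ I (ν' + 1 + d) k, ∀ l, x ∈ I (ν' + 1) l ↔ k / 2 ^ d = l := by
      intro x hx l
      have h0 := nonneg_of_mem hx
      rw [mem_I h0] at hx
      rw [mem_I h0, floor_half (d := d), hx]
    refine ⟨(if k / 2 ^ d = 2 * k' then (((r α)⁻¹ : ℝ) : ℂ) else 0) +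
      (if k / 2 ^ d = 2 * k' + 1 then -((r α : ℝ) : ℂ) else 0), fun x hx => ?_⟩
    classical
    rw [chi_eq α hk', Set.indicator_apply, Set.indicator_apply]
    simp only [key x hx]

/-- The defining property of the distorted measure. -/
def HM (α : ℝ) (μ : Measure ℝ) : Prop := ∀ ν k : ℕ, k < 2 ^ ν →
      μ (Set.Ico ((k : ℝ) / 2 ^ ν) (((k : ℝ) + 1) / 2 ^ ν)) =
        ENNReal.ofReal (∏ s ∈ Finset.range ν, if k / 2 ^ s % 2 = 0 then α else 1 - α)

section
variable {α : ℝ} {μ : Measure ℝ}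

lemma r_pos (hα0 : 0 < α) (hα : α ≤ 1 / 2) : 0 < r α :=
  Real.sqrt_pos.2 (div_pos hα0 (by linarith))

lemma r_sq (hα0 : 0 < α) (hα : α ≤ 1 / 2) : r α * r α * (1 - α) = α := by
  have h : 0 < 1 - α := by linarith
  rw [r, Real.mul_self_sqrt (div_pos hα0 h).le]
  field_simp

lemma mass_pow (hα0 : 0 < α) (hα : α ≤ 1 / 2) (hμ : HM α μ) {ν k : ℕ} (hk : k < 2 ^ ν) :
    μ.real (I ν k) = ∏ s ∈ Finset.range ν, if k / 2 ^ s % 2 = 0 then α else 1 - α := by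
  rw [measureReal_def, I, hμ ν k hk, ENNReal.toReal_ofReal]
  refine Finset.prod_nonneg fun s _ => ?_
  split_ifs <;> linarith

lemma mass_pos (hα0 : 0 < α) (hα : α ≤ 1 / 2) (hμ : HM α μ) {ν k : ℕ} (hk : k < 2 ^ ν) :
    0 < μ.real (I ν k) := by
  rw [mass_pow hα0 hα hμ hk]
  refine Finset.prod_pos fun s _ => ?_
  split_ifs <;> linarith

lemma mass_left (hα0 : 0 < α) (hα : α ≤ 1 / 2) (hμ : HM α μ) {ν k : ℕ} (hk : k < 2 ^ ν) :
    μ.real (I (ν + 1) (2 * k)) = α * μ.real (I ν k) := by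
  rw [mass_pow hα0 hα hμ hk, mass_pow hα0 hα hμ (by rw [pow_succ]; omega),
    Finset.prod_range_succ', mul_comm]
  congr 1
  · simp
  · refine Finset.prod_congr rfl fun s _ => ?_
    rw [pow_succ', ← Nat.div_div_eq_div_mul, show 2 * k / 2 = k by omega]

lemma mass_right (hα0 : 0 < α) (hα : α ≤ 1 / 2) (hμ : HM α μ) {ν k : ℕ} (hk : k < 2 ^ ν) :
    μ.real (I (ν + 1) (2 * k + 1)) = (1 - α) * μ.real (I ν k) := by
  rw [mass_pow hα0 hα hμ hk, mass_pow hα0 hα hμ (by rw [pow_succ]; omega),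
    Finset.prod_range_succ', mul_comm]
  congr 1
  · simp
  · refine Finset.prod_congr rfl fun s _ => ?_
    rw [pow_succ', ← Nat.div_div_eq_div_mul, show (2 * k + 1) / 2 = k by omega]

variable [IsProbabilityMeasure μ]

lemma ae_mem (hμ : HM α μ) : ∀ᵐ x ∂μ, x ∈ Set.Ico (0 : ℝ) 1 := by
  have h := hμ 0 0 (by norm_num)
  simp at h
  exact (mem_ae_iff_prob_eq_one measurableSet_Ico).2 h

lemma ae_mem_I (hμ : HM α μ) (ν : ℕ) : ∀ᵐ x ∂μ, ∃ k, k < 2 ^ ν ∧ x ∈ I ν k := by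
  filter_upwards [ae_mem hμ] with x hx
  rw [← I_union ν] at hx
  simpa using hx

lemma int_dec {E : Type*} [NormedAddCommGroup E] [NormedSpace ℝ E] (hμ : HM α μ) (ν : ℕ)
    {g : ℝ → E} (hg : Integrable g μ) :
    ∫ x, g x ∂μ = ∑ k ∈ Finset.range (2 ^ ν), ∫ x in I ν k, g x ∂μ := by
  rw [← integral_biUnion_finset _ (fun k _ => measI ν k) (fun i _ j _ h => I_disj ν h)
    (fun i _ => hg.integrableOn), I_union, Measure.restrict_eq_self_of_ae_mem (ae_mem hμ)]

lemma chi_int (j : ℕ) : Integrable (chi α j) μ :=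
  Integrable.of_bound (chi_meas α j).aestronglyMeasurable (M α)
    (Filter.Eventually.of_forall (chi_bound α j))

lemma mul_chi_int {g : ℝ → ℂ} (hg : Integrable g μ) (j : ℕ) :
    Integrable (fun x => g x * chi α j x) μ :=
  hg.mul_bdd (c := M α) (chi_meas α j).aestronglyMeasurable
    (Filter.Eventually.of_forall (chi_bound α j))

lemma int_mul_chi {g : ℝ → ℂ} (hg : Integrable g μ) {ν k : ℕ} (hk : k < 2 ^ ν) :
    ∫ x, g x * chi α (2 ^ ν + k) x ∂μ =
      (∫ x in I (ν + 1) (2 * k), g x ∂μ) * (((r α)⁻¹ : ℝ) : ℂ)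
      + (∫ x in I (ν + 1) (2 * k + 1), g x ∂μ) * (-((r α : ℝ) : ℂ)) := by
  have h1 : ∫ x, g x * chi α (2 ^ ν + k) x ∂μ
      = ∫ x in I ν k, g x * chi α (2 ^ ν + k) x ∂μ := by
    rw [setIntegral_eq_integral_of_forall_compl_eq_zero]
    intro x hx
    rw [chi_out α hk hx, mul_zero]
  rw [h1, I_split, setIntegral_union (I_disj _ (by omega)) (measI _ _)
    (mul_chi_int hg _).integrableOn (mul_chi_int hg _).integrableOn,
    ← integral_mul_const, ← integral_mul_const]
  congr 1
  · refine setIntegral_congr_fun (measI _ _) fun x hx => ?_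
    simp only [chi_left α hk hx]
  · refine setIntegral_congr_fun (measI _ _) fun x hx => ?_
    simp only [chi_right α hk hx]

lemma rC (hα0 : 0 < α) (hα : α ≤ 1 / 2) :
    (r α : ℂ) * (r α : ℂ) * (1 - (α : ℂ)) = α := by
  exact_mod_cast r_sq hα0 hα

lemma orth (hα0 : 0 < α) (hα : α ≤ 1 / 2) (hμ : HM α μ) {i j : ℕ} (hij : i < j) :
    ∫ x, chi α i x * chi α j x ∂μ = 0 := by
  obtain ⟨ν, k, hk, rfl⟩ := exists_idx (show j ≠ 0 by omega)
  obtain ⟨v, hv⟩ := chi_const α hk hij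
  rw [int_mul_chi (chi_int i) hk]
  have e1 : ∫ x in I (ν + 1) (2 * k), chi α i x ∂μ = ((α * μ.real (I ν k) : ℝ) : ℂ) * v := by
    rw [← mass_left hα0 hα hμ hk, setIntegral_congr_fun (g := fun _ => v) (measI _ _),
      setIntegral_const, Complex.real_smul]
    intro x hx
    exact hv x (by rw [I_split]; exact Or.inl hx)
  have e2 : ∫ x in I (ν + 1) (2 * k + 1), chi α i x ∂μ
      = (((1 - α) * μ.real (I ν k) : ℝ) : ℂ) * v := by
    rw [← mass_right hα0 hα hμ hk, setIntegral_congr_fun (g := fun _ => v) (measI _ _),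
      setIntegral_const, Complex.real_smul]
    intro x hx
    exact hv x (by rw [I_split]; exact Or.inr hx)
  rw [e1, e2]
  have hr : (r α : ℂ) ≠ 0 := by exact_mod_cast (r_pos hα0 hα).ne'
  have h := rC hα0 hα
  push_cast
  field_simp
  linear_combination (-(μ.real (I ν k) : ℂ) * v) * h

lemma orth_ne (hα0 : 0 < α) (hα : α ≤ 1 / 2) (hμ : HM α μ) {i j : ℕ} (hij : i ≠ j) :
    ∫ x, chi α i x * chi α j x ∂μ = 0 := by
  rcases lt_or_gt_of_ne hij with h | h
  · exact orth hα0 hα hμ h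
  · simp_rw [mul_comm (chi α i _)]
    exact orth hα0 hα hμ h

lemma normsq (hα0 : 0 < α) (hα : α ≤ 1 / 2) (hμ : HM α μ) {ν k : ℕ} (hk : k < 2 ^ ν) :
    ∫ x, chi α (2 ^ ν + k) x * chi α (2 ^ ν + k) x ∂μ = (μ.real (I ν k) : ℂ) := by
  rw [int_mul_chi (chi_int _) hk]
  have e1 : ∫ x in I (ν + 1) (2 * k), chi α (2 ^ ν + k) x ∂μ
      = ((α * μ.real (I ν k) : ℝ) : ℂ) * (((r α)⁻¹ : ℝ) : ℂ) := by
    rw [← mass_left hα0 hα hμ hk,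
      setIntegral_congr_fun (g := fun _ => (((r α)⁻¹ : ℝ) : ℂ)) (measI _ _),
      setIntegral_const, Complex.real_smul]
    intro x hx
    exact chi_left α hk hx
  have e2 : ∫ x in I (ν + 1) (2 * k + 1), chi α (2 ^ ν + k) x ∂μ
      = (((1 - α) * μ.real (I ν k) : ℝ) : ℂ) * (-((r α : ℝ) : ℂ)) := by
    rw [← mass_right hα0 hα hμ hk,
      setIntegral_congr_fun (g := fun _ => (-((r α : ℝ) : ℂ))) (measI _ _),
      setIntegral_const, Complex.real_smul]
    intro x hx
    exact chi_right α hk hx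
  rw [e1, e2]
  have hr : (r α : ℂ) ≠ 0 := by exact_mod_cast (r_pos hα0 hα).ne'
  have h := rC hα0 hα
  push_cast
  field_simp
  linear_combination (μ.real (I ν k) : ℂ) * ((r α : ℂ) ^ 2 - 1) * h

lemma normsq_zero : ∫ x, chi α 0 x * chi α 0 x ∂μ = 1 := by
  simp [chi_zero]

lemma normsq_ne (hα0 : 0 < α) (hα : α ≤ 1 / 2) (hμ : HM α μ) (j : ℕ) :
    ∫ x, chi α j x * chi α j x ∂μ ≠ 0 := by
  rcases eq_or_ne j 0 with rfl | hj
  · rw [normsq_zero]; exact one_ne_zero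
  · obtain ⟨ν, k, hk, rfl⟩ := exists_idx hj
    rw [normsq hα0 hα hμ hk]
    exact_mod_cast (mass_pos hα0 hα hμ hk).ne'

variable (α μ) in
/-- The coefficients. -/
def cf (f : ℝ → ℂ) (j : ℕ) : ℂ := (∫ x, f x * chi α j x ∂μ) / ∫ x, chi α j x * chi α j x ∂μ

lemma sum_int (c : ℕ → ℂ) (s : Finset ℕ) :
    Integrable (fun x => ∑ j ∈ s, c j * chi α j x) μ :=
  integrable_finsetSum _ fun j _ => (chi_int j).const_mul (c j)

lemma int_sum_chi (hα0 : 0 < α) (hα : α ≤ 1 / 2) (hμ : HM α μ) (c : ℕ → ℂ) (s : Finset ℕ)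
    (i : ℕ) : ∫ x, (∑ j ∈ s, c j * chi α j x) * chi α i x ∂μ
      = if i ∈ s then c i * ∫ x, chi α i x * chi α i x ∂μ else 0 := by
  simp_rw [Finset.sum_mul, mul_assoc]
  rw [integral_finsetSum _ fun j _ => ((mul_chi_int (chi_int j) i).const_mul (c j))]
  simp_rw [integral_const_mul]
  split_ifs with h
  · rw [Finset.sum_eq_single_of_mem i h]
    intro j _ hj
    rw [orth_ne hα0 hα hμ hj, mul_zero]
  · refine Finset.sum_eq_zero fun j hj => ?_
    rw [orth_ne hα0 hα hμ (show j ≠ i from fun e => h (e ▸ hj)), mul_zero]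

lemma uniq (hα0 : 0 < α) (hα : α ≤ 1 / 2) (hμ : HM α μ) {f : ℝ → ℂ} (hf : Integrable f μ)
    (c : ℕ → ℂ)
    (hc : Filter.Tendsto (fun n => ∫ x, ‖f x - ∑ j ∈ Finset.range n, c j * chi α j x‖ ∂μ)
        Filter.atTop (nhds 0)) : c = cf α μ f := by
  ext i
  rw [cf, eq_div_iff (normsq_ne hα0 hα hμ i)]
  have hz : ‖(∫ x, f x * chi α i x ∂μ) - c i * ∫ x, chi α i x * chi α i x ∂μ‖ ≤ 0 := by
    have hc' := hc.mul_const (M α)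
    rw [zero_mul] at hc'
    refine ge_of_tendsto hc' ?_
    filter_upwards [Filter.eventually_gt_atTop i] with n hn
    have h := int_sum_chi hα0 hα hμ c (Finset.range n) i
    rw [if_pos (Finset.mem_range.2 hn)] at h
    rw [← h, ← integral_sub (mul_chi_int hf i) (mul_chi_int (sum_int c _) i), ← integral_mul_const]
    refine norm_integral_le_of_norm_le ((hf.sub (sum_int c _)).norm.mul_const _) ?_
    refine Filter.Eventually.of_forall fun x => ?_
    rw [← sub_mul, norm_mul]
    exact mul_le_mul_of_nonneg_left (chi_bound α i x) (norm_nonneg _)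
  rw [norm_le_zero_iff, sub_eq_zero] at hz
  exact hz.symm

variable (α μ) in
/-- The partial sums. -/
def S (f : ℝ → ℂ) (n : ℕ) (x : ℝ) : ℂ := ∑ j ∈ Finset.range n, cf α μ f j * chi α j x

lemma S_int (f : ℝ → ℂ) (n : ℕ) : Integrable (S α μ f n) μ := sum_int _ _

lemma S_avg (hα0 : 0 < α) (hα : α ≤ 1 / 2) (hμ : HM α μ) {f : ℝ → ℂ} (hf : Integrable f μ)
    (ν : ℕ) : ∀ k, k < 2 ^ ν → ∀ x ∈ I ν k,
      S α μ f (2 ^ ν) x = (∫ y in I ν k, f y ∂μ) / (μ.real (I ν k) : ℂ) := by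
  induction ν with
  | zero =>
    intro k hk x hx
    obtain rfl : k = 0 := by simpa using hk
    have h1 := int_dec hμ 0 hf
    rw [pow_zero, Finset.sum_range_one] at h1
    rw [← h1, mass_pow hα0 hα hμ hk, S, pow_zero, Finset.sum_range_one, cf, normsq_zero]
    simp [chi_zero]
  | succ ν ih =>
    intro k' hk' x hx
    obtain ⟨k, hkk⟩ : ∃ k, k' = 2 * k ∨ k' = 2 * k + 1 := ⟨k' / 2, by omega⟩
    have hk : k < 2 ^ ν := by rw [pow_succ] at hk'; omega
    have hxk : x ∈ I ν k := by
      rw [I_split]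
      rcases hkk with rfl | rfl
      · exact Or.inl hx
      · exact Or.inr hx
    have hsum : S α μ f (2 ^ (ν + 1)) x
        = S α μ f (2 ^ ν) x + cf α μ f (2 ^ ν + k) * chi α (2 ^ ν + k) x := by
      rw [S, pow_succ, mul_two, Finset.sum_range_add, S]
      congr 1
      refine Finset.sum_eq_single_of_mem k (Finset.mem_range.2 hk) fun l hl hlk => ?_
      rw [chi_out α (Finset.mem_range.1 hl), mul_zero]
      exact fun h => Set.disjoint_left.1 (I_disj ν hlk) h hxk
    rw [hsum, ih k hk x hxk, cf, normsq hα0 hα hμ hk, int_mul_chi hf hk]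
    have hI : ∫ y in I ν k, f y ∂μ = (∫ y in I (ν + 1) (2 * k), f y ∂μ)
        + ∫ y in I (ν + 1) (2 * k + 1), f y ∂μ := by
      rw [I_split, setIntegral_union (I_disj _ (by omega)) (measI _ _)
        hf.integrableOn hf.integrableOn]
    rw [hI]
    have hm : (μ.real (I ν k) : ℂ) ≠ 0 := by exact_mod_cast (mass_pos hα0 hα hμ hk).ne'
    have hr : (r α : ℂ) ≠ 0 := by exact_mod_cast (r_pos hα0 hα).ne'
    have h1 : (α : ℂ) ≠ 0 := by exact_mod_cast hα0.ne'
    have h2 : (1 - (α : ℂ)) ≠ 0 := by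
      have : 1 - α ≠ 0 := by linarith
      exact_mod_cast this
    have h := rC hα0 hα
    generalize hA : (∫ y in I (ν + 1) (2 * k), f y ∂μ) = A
    generalize hB : (∫ y in I (ν + 1) (2 * k + 1), f y ∂μ) = B
    rcases hkk with rfl | rfl
    · rw [hA, mass_left hα0 hα hμ hk, chi_left α hk hx]
      have hinv : (r α : ℂ)⁻¹ * (r α : ℂ)⁻¹ = (1 - α) / α := by
        field_simp
        linear_combination -h
      push_cast
      calc _ = ((A + B) + A * ((r α : ℂ)⁻¹ * (r α : ℂ)⁻¹) - B * ((r α : ℂ) * (r α : ℂ)⁻¹))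
            / (μ.real (I ν k) : ℂ) := by ring
        _ = _ := by
          rw [hinv, mul_inv_cancel₀ hr]
          field_simp
          ring
    · rw [hB, mass_right hα0 hα hμ hk, chi_right α hk hx]
      have hsq : (r α : ℂ) * (r α : ℂ) = α / (1 - α) := by
        rw [eq_div_iff h2, h]
      push_cast
      calc _ = ((A + B) - A * ((r α : ℂ) * (r α : ℂ)⁻¹) + B * ((r α : ℂ) * (r α : ℂ)))
            / (μ.real (I ν k) : ℂ) := by ring
        _ = _ := by
          rw [hsq, mul_inv_cancel₀ hr]
          field_simp
          ring

lemma S_contr (hα0 : 0 < α) (hα : α ≤ 1 / 2) (hμ : HM α μ) {f : ℝ → ℂ} (hf : Integrable f μ)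
    (ν : ℕ) : ∫ x, ‖S α μ f (2 ^ ν) x‖ ∂μ ≤ ∫ x, ‖f x‖ ∂μ := by
  rw [int_dec hμ ν (S_int f _).norm, int_dec hμ ν hf.norm]
  refine Finset.sum_le_sum fun k hk => ?_
  have hk := Finset.mem_range.1 hk
  have hm := mass_pos hα0 hα hμ hk
  rw [setIntegral_congr_fun (g := fun _ => ‖(∫ y in I ν k, f y ∂μ) / (μ.real (I ν k) : ℂ)‖)
    (measI _ _) (fun x hx => by simp only [S_avg hα0 hα hμ hf ν k hk x hx]), setIntegral_const,
    norm_div, Complex.norm_real, Real.norm_of_nonneg hm.le, smul_eq_mul, mul_div_cancel₀ _ hm.ne']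
  exact norm_integral_le_integral_norm _

lemma cf_sub {f g : ℝ → ℂ} (hf : Integrable f μ) (hg : Integrable g μ) (j : ℕ) :
    cf α μ (fun x => f x - g x) j = cf α μ f j - cf α μ g j := by
  simp only [cf, sub_mul]
  rw [integral_sub (mul_chi_int hf j) (mul_chi_int hg j), sub_div]

lemma S_sub {f g : ℝ → ℂ} (hf : Integrable f μ) (hg : Integrable g μ) (n : ℕ) (x : ℝ) :
    S α μ (fun x => f x - g x) n x = S α μ f n x - S α μ g n x := by
  simp only [S, cf_sub hf hg, sub_mul, Finset.sum_sub_distrib]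

lemma cf_S (hα0 : 0 < α) (hα : α ≤ 1 / 2) (hμ : HM α μ) {f : ℝ → ℂ} {n j : ℕ} (h : n ≤ j) :
    cf α μ (S α μ f n) j = 0 := by
  rw [cf]
  unfold S
  rw [int_sum_chi hα0 hα hμ, if_neg (by simpa using h), zero_div]

/-- A single term is controlled by the local mass of `g`. -/
lemma term_bound (hα0 : 0 < α) (hα : α ≤ 1 / 2) (hμ : HM α μ) {g : ℝ → ℂ} (hg : Integrable g μ)
    {ν k : ℕ} (hk : k < 2 ^ ν) :
    ∫ x, ‖cf α μ g (2 ^ ν + k) * chi α (2 ^ ν + k) x‖ ∂μ ≤ M α ^ 2 * ∫ x in I ν k, ‖g x‖ ∂μ := by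
  have hm := mass_pos hα0 hα hμ hk
  have hM := M_nonneg α
  have h1 : ‖∫ x, g x * chi α (2 ^ ν + k) x ∂μ‖ ≤ M α * ∫ x in I ν k, ‖g x‖ ∂μ := by
    rw [← setIntegral_eq_integral_of_forall_compl_eq_zero (s := I ν k)
      (fun x hx => by rw [chi_out α hk hx, mul_zero]), ← integral_const_mul]
    refine norm_integral_le_of_norm_le (hg.norm.integrableOn.const_mul _)
      (Filter.Eventually.of_forall fun x => ?_)
    rw [norm_mul, mul_comm]
    exact mul_le_mul_of_nonneg_right (chi_bound _ _ _) (norm_nonneg _)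
  have h2 : ∫ x, ‖chi α (2 ^ ν + k) x‖ ∂μ ≤ M α * μ.real (I ν k) := by
    rw [← setIntegral_eq_integral_of_forall_compl_eq_zero (s := I ν k)
      (fun x hx => by rw [chi_out α hk hx, norm_zero])]
    calc ∫ x in I ν k, ‖chi α (2 ^ ν + k) x‖ ∂μ ≤ ∫ x in I ν k, M α ∂μ :=
          integral_mono (chi_int _).norm.integrableOn (integrable_const _) fun x => chi_bound _ _ _
      _ = M α * μ.real (I ν k) := by rw [setIntegral_const, smul_eq_mul, mul_comm]
  simp_rw [norm_mul]
  rw [integral_const_mul, cf, normsq hα0 hα hμ hk, norm_div, Complex.norm_real,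
    Real.norm_of_nonneg hm.le]
  have h0 : 0 ≤ ∫ x in I ν k, ‖g x‖ ∂μ := integral_nonneg fun x => norm_nonneg _
  calc _ ≤ (M α * ∫ x in I ν k, ‖g x‖ ∂μ) / μ.real (I ν k) * (M α * μ.real (I ν k)) := by
        gcongr
    _ = _ := by field_simp

lemma S_mid (hα0 : 0 < α) (hα : α ≤ 1 / 2) (hμ : HM α μ) {f : ℝ → ℂ} (hf : Integrable f μ)
    {ν k : ℕ} (hk : k < 2 ^ ν) :
    ∫ x, ‖f x - S α μ f (2 ^ ν + k) x‖ ∂μ ≤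
      (1 + M α ^ 2) * ∫ x, ‖f x - S α μ f (2 ^ ν) x‖ ∂μ := by
  set g : ℝ → ℂ := fun x => f x - S α μ f (2 ^ ν) x with hgdef
  have hg : Integrable g μ := hf.sub (S_int f _)
  have hc : ∀ l, cf α μ f (2 ^ ν + l) = cf α μ g (2 ^ ν + l) := by
    intro l
    rw [hgdef, cf_sub hf (S_int f _), cf_S hα0 hα hμ (by omega), sub_zero]
  have hpt : ∀ x, f x - S α μ f (2 ^ ν + k) x
      = g x - ∑ l ∈ Finset.range k, cf α μ g (2 ^ ν + l) * chi α (2 ^ ν + l) x := by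
    intro x
    simp only [← hc]
    rw [hgdef, S, Finset.sum_range_add]
    simp only [S]
    ring
  have hti : ∀ l, Integrable (fun x => ‖cf α μ g (2 ^ ν + l) * chi α (2 ^ ν + l) x‖) μ :=
    fun l => ((chi_int _).const_mul _).norm
  calc ∫ x, ‖f x - S α μ f (2 ^ ν + k) x‖ ∂μ
      ≤ ∫ x, (‖g x‖ + ∑ l ∈ Finset.range (2 ^ ν),
          ‖cf α μ g (2 ^ ν + l) * chi α (2 ^ ν + l) x‖) ∂μ := by
        refine integral_mono (hf.sub (S_int f _)).norm
          (hg.norm.add (integrable_finsetSum _ fun l _ => hti l)) fun x => ?_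
        simp only [hpt]
        refine (norm_sub_le _ _).trans (add_le_add le_rfl ((norm_sum_le _ _).trans ?_))
        exact Finset.sum_le_sum_of_subset_of_nonneg (Finset.range_subset_range.2 hk.le)
          fun _ _ _ => norm_nonneg _
    _ = ∫ x, ‖g x‖ ∂μ + ∑ l ∈ Finset.range (2 ^ ν),
          ∫ x, ‖cf α μ g (2 ^ ν + l) * chi α (2 ^ ν + l) x‖ ∂μ := by
        rw [integral_add hg.norm (integrable_finsetSum _ fun l _ => hti l),
          integral_finsetSum _ fun l _ => hti l]
    _ ≤ ∫ x, ‖g x‖ ∂μ + ∑ l ∈ Finset.range (2 ^ ν), M α ^ 2 * ∫ x in I ν l, ‖g x‖ ∂μ := by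
        gcongr with l hl
        exact term_bound hα0 hα hμ hg (Finset.mem_range.1 hl)
    _ = (1 + M α ^ 2) * ∫ x, ‖g x‖ ∂μ := by
        rw [← Finset.mul_sum, ← int_dec hμ ν hg.norm]; ring

lemma dyadic_unif (hα0 : 0 < α) (hα : α ≤ 1 / 2) (hμ : HM α μ) {g : ℝ → ℂ} (hg : Integrable g μ)
    (hu : UniformContinuous g) {ε : ℝ} (hε : 0 < ε) :
    ∀ᶠ ν : ℕ in Filter.atTop, ∫ x, ‖g x - S α μ g (2 ^ ν) x‖ ∂μ ≤ ε := by
  obtain ⟨δ, hδ, hd⟩ := Metric.uniformContinuous_iff.1 hu ε hε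
  obtain ⟨N, hN⟩ := exists_pow_lt_of_lt_one hδ (show (1 / 2 : ℝ) < 1 by norm_num)
  filter_upwards [Filter.eventually_ge_atTop N] with ν hν
  have hsmall : (1 : ℝ) / 2 ^ ν < δ := by
    rw [← one_div_pow]
    exact (pow_le_pow_of_le_one (by norm_num) (by norm_num) hν).trans_lt hN
  have hb : ∀ᵐ x ∂μ, ‖g x - S α μ g (2 ^ ν) x‖ ≤ ε := by
    filter_upwards [ae_mem_I hμ ν] with x ⟨k, hk, hx⟩
    have hm := mass_pos hα0 hα hμ hk
    have hmC : (μ.real (I ν k) : ℂ) ≠ 0 := by exact_mod_cast hm.ne'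
    rw [S_avg hα0 hα hμ hg ν k hk x hx]
    have : g x - (∫ y in I ν k, g y ∂μ) / (μ.real (I ν k) : ℂ)
        = (∫ y in I ν k, (g x - g y) ∂μ) / (μ.real (I ν k) : ℂ) := by
      rw [integral_sub (integrable_const _) hg.integrableOn, setIntegral_const, Complex.real_smul]
      field_simp
    rw [this, norm_div, Complex.norm_real, Real.norm_of_nonneg hm.le, div_le_iff₀ hm]
    refine norm_setIntegral_le_of_norm_le_const (measure_lt_top _ _) fun y hy => ?_
    rw [← dist_eq_norm]
    refine (hd ?_).le
    rw [Real.dist_eq, abs_lt]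
    have e : ((k : ℝ) + 1) / 2 ^ ν = k / 2 ^ ν + 1 / 2 ^ ν := by ring
    have a1 := hx.1
    have a2 := hx.2
    have b1 := hy.1
    have b2 := hy.2
    rw [e] at a2 b2
    constructor <;> linarith
  calc ∫ x, ‖g x - S α μ g (2 ^ ν) x‖ ∂μ ≤ ∫ x, ε ∂μ :=
        integral_mono_ae (hg.sub (S_int g _)).norm (integrable_const _) hb
    _ = ε := by simp

lemma dyadic_tendsto (hα0 : 0 < α) (hα : α ≤ 1 / 2) (hμ : HM α μ) {f : ℝ → ℂ}
    (hf : Integrable f μ) {ε : ℝ} (hε : 0 < ε) :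
    ∀ᶠ ν : ℕ in Filter.atTop, ∫ x, ‖f x - S α μ f (2 ^ ν) x‖ ∂μ ≤ ε := by
  obtain ⟨g, hgs, hgf, hgc, hg⟩ := hf.exists_hasCompactSupport_integral_sub_le
    (show 0 < ε / 3 by positivity)
  have hu : UniformContinuous g := hgs.uniformContinuous_of_continuous hgc
  filter_upwards [dyadic_unif hα0 hα hμ hg hu (show 0 < ε / 3 by positivity)] with ν hν
  have hfg : Integrable (fun x => f x - g x) μ := hf.sub hg
  have hc := S_contr hα0 hα hμ hfg ν
  have i1 := hfg.norm
  have i2 : Integrable (fun x => ‖g x - S α μ g (2 ^ ν) x‖) μ := (hg.sub (S_int g _)).norm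
  have i3 : Integrable (fun x => ‖S α μ (fun x => f x - g x) (2 ^ ν) x‖) μ := (S_int _ _).norm
  calc ∫ x, ‖f x - S α μ f (2 ^ ν) x‖ ∂μ
      ≤ ∫ x, (‖f x - g x‖ + ‖g x - S α μ g (2 ^ ν) x‖
          + ‖S α μ (fun x => f x - g x) (2 ^ ν) x‖) ∂μ := by
        refine integral_mono (hf.sub (S_int f _)).norm ((i1.add i2).add i3) fun x => ?_
        have e : f x - S α μ f (2 ^ ν) x = (f x - g x) + (g x - S α μ g (2 ^ ν) x)
            - S α μ (fun x => f x - g x) (2 ^ ν) x := by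
          rw [S_sub hf hg]; ring
        simp only [e]
        exact (norm_sub_le _ _).trans (add_le_add (norm_add_le _ _) le_rfl)
    _ = ∫ x, ‖f x - g x‖ ∂μ + ∫ x, ‖g x - S α μ g (2 ^ ν) x‖ ∂μ
          + ∫ x, ‖S α μ (fun x => f x - g x) (2 ^ ν) x‖ ∂μ := by
        have i12 : Integrable (fun x => ‖f x - g x‖ + ‖g x - S α μ g (2 ^ ν) x‖) μ := i1.add i2
        rw [integral_add i12 i3, integral_add i1 i2]
    _ ≤ ε := by linarith

lemma S_tendsto (hα0 : 0 < α) (hα : α ≤ 1 / 2) (hμ : HM α μ) {f : ℝ → ℂ} (hf : Integrable f μ) :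
    Filter.Tendsto (fun n => ∫ x, ‖f x - S α μ f n x‖ ∂μ) Filter.atTop (nhds 0) := by
  rw [Metric.tendsto_atTop]
  intro ε hε
  have hC : 0 < 1 + M α ^ 2 := by positivity
  obtain ⟨N, hN⟩ := Filter.eventually_atTop.1
    (dyadic_tendsto hα0 hα hμ hf (show 0 < ε / 2 / (1 + M α ^ 2) by positivity))
  refine ⟨2 ^ N, fun n hn => ?_⟩
  have hpos : 0 < 2 ^ N := by positivity
  obtain ⟨ν, k, hk, rfl⟩ := exists_idx (show n ≠ 0 by omega)
  have hν : N ≤ ν := by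
    by_contra hc
    have : 2 ^ (ν + 1) ≤ 2 ^ N := Nat.pow_le_pow_right (by norm_num) (by omega)
    rw [pow_succ] at this
    omega
  have h1 := S_mid hα0 hα hμ hf hk
  have h2 := mul_le_mul_of_nonneg_left (hN ν hν) hC.le
  rw [mul_div_cancel₀ _ hC.ne'] at h2
  rw [Real.dist_eq, sub_zero, abs_of_nonneg (integral_nonneg fun x => norm_nonneg _)]
  linarith

end

end ChiBasis

open MeasureTheory in
/-- the system `χ` is a Schauder basis of `L¹([0,1), m_α)`, where `m_α` is the
distorted product measure with `m_α([k 2^{-ν}, (k+1) 2^{-ν})) = Π_s ((1-ε_s)α + ε_s(1-α))`,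
`ε_s` the binary digits of `k`.  (For `α = 1/2` this is the classical Haar basis of `L¹(0,1)`.) -/
theorem chi_schauder_basis_L1
    (α : ℝ) (hα0 : 0 < α) (hα : α ≤ 1 / 2)
    (μ : Measure ℝ) [IsProbabilityMeasure μ]
    (hμ : ∀ ν k : ℕ, k < 2 ^ ν →
      μ (Set.Ico ((k : ℝ) / 2 ^ ν) (((k : ℝ) + 1) / 2 ^ ν)) =
        ENNReal.ofReal (∏ s ∈ Finset.range ν, if k / 2 ^ s % 2 = 0 then α else 1 - α))
    (f : ℝ → ℂ) (hf : Integrable f μ) :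
    ∃! c : ℕ → ℂ,
      Filter.Tendsto (fun n => ∫ x, ‖f x - ∑ j ∈ Finset.range n, c j * chi α j x‖ ∂μ)
        Filter.atTop (nhds 0) := by
  exact ⟨ChiBasis.cf α μ f, ChiBasis.S_tendsto hα0 hα hμ hf,
    fun c hc => ChiBasis.uniq hα0 hα hμ hf c hc⟩

end
end
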